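/- arXiv:2601.12229 — 2 statements merged into one kernel-verified Lean document; each statement's English description precedes it below -/
import Mathlib

section
/- Let γ₁ > 0, k > 0, 𝔠 < 0 (so that a critical layer is present), let ε₁ ∈ (0,1) satisfy ε₁·e^{ε₁} < 1, and set M₁ := ε₁·k𝔠 < 0. Then: (a) there exists exactly one real number Ȳ with −M₁·e^{−Ȳ} − k𝔠 − γ₁·Ȳ = 0, this Ȳ is strictly positive, and the Hessian of H₁ at (π, Ȳ) is diagonal with entries −M₁·e^{−Ȳ} > 0 and M₁·e^{−Ȳ} − γ₁ < 0 (a nondegenerate saddle); (b) the equation M₁·e^{−Y} − k𝔠 − γ₁·Y = 0 has exactly two real solutions Y⁻ < 0 < Y⁺, and they satisfy −M₁·e^{−Y⁺} < γ₁ < −M₁·e^{−Y⁻}, so that (0, Y⁺) is a nondegenerate local maximum of H₁ (the centre of the Kelvin cat's-eye vortex in the critical layer) and (0, Y⁻) is a nondegenerate saddle point of H₁. -/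
/-- The Hamiltonian of the upper-layer travelling-wave system in the case
`A = 1`: `H₁(X,Y) = −M₁ cos X e^{−Y} − (γ₁/2)Y² − ν Y` with `ν = k𝔠`. -/
noncomputable def H₁ (M₁ ν γ₁ X Y : ℝ) : ℝ :=
  -M₁ * Real.cos X * Real.exp (-Y) - (γ₁ / 2) * Y ^ 2 - ν * Y

open Filter Topology in
theorem not_isLocalMax_of_deriv_deriv_pos {f : ℝ → ℝ} {x : ℝ} (h₂ : 0 < deriv (deriv f) x)
    (h₁ : deriv f x = 0) (hc : ContinuousAt f x) : ¬ IsLocalMax f x := by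
  intro hmax
  have hmin := isLocalMin_of_deriv_deriv_pos h₂ h₁ hc
  have heq : f =ᶠ[𝓝 x] fun _ => f x := by
    filter_upwards [hmax, hmin] with y hy hy' using le_antisymm hy hy'
  have h0 := heq.deriv.deriv_eq
  simp only [deriv_const', deriv_const] at h0
  exact h₂.ne' h0

theorem not_isLocalMin_of_deriv_deriv_neg {f : ℝ → ℝ} {x : ℝ} (h₂ : deriv (deriv f) x < 0)
    (h₁ : deriv f x = 0) (hc : ContinuousAt f x) : ¬ IsLocalMin f x := by
  intro hmin
  refine not_isLocalMax_of_deriv_deriv_pos (f := -f) (x := x) ?_ ?_ hc.neg hmin.neg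
  · have h : deriv (-f) = -deriv f := by
      ext y
      exact deriv.neg
    rw [h, deriv.neg]
    linarith
  · rw [deriv.neg, h₁, neg_zero]

section Hamiltonian

variable (M ν γ X Y : ℝ)

theorem H₁_deriv_fst :
    deriv (fun X => H₁ M ν γ X Y) = fun X => M * Real.sin X * Real.exp (-Y) := by
  ext X
  unfold H₁
  have h := ((((Real.hasDerivAt_cos X).const_mul (-M)).mul_const (Real.exp (-Y))).sub_const
    ((γ / 2) * Y ^ 2)).sub_const (ν * Y)
  rw [h.deriv]
  ring

theorem H₁_deriv_snd :
    deriv (fun Y => H₁ M ν γ X Y) = fun Y => M * Real.cos X * Real.exp (-Y) - γ * Y - ν := by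
  ext Y
  unfold H₁
  have h := ((((hasDerivAt_neg Y).exp).const_mul (-M * Real.cos X)).sub
    (((hasDerivAt_id Y).pow 2).const_mul (γ / 2))).sub ((hasDerivAt_id Y).const_mul ν)
  refine (h.congr_deriv ?_).deriv
  simp
  ring

theorem H₁_deriv_fst_fst :
    deriv (deriv (fun X => H₁ M ν γ X Y)) X = M * Real.cos X * Real.exp (-Y) := by
  rw [H₁_deriv_fst]
  exact (((Real.hasDerivAt_sin X).const_mul M).mul_const (Real.exp (-Y))).deriv

theorem H₁_deriv_snd_snd :
    deriv (deriv (fun Y => H₁ M ν γ X Y)) Y = -M * Real.cos X * Real.exp (-Y) - γ := by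
  rw [H₁_deriv_snd]
  have h := ((((hasDerivAt_neg Y).exp).const_mul (M * Real.cos X)).sub
    ((hasDerivAt_id Y).const_mul γ)).sub_const ν
  refine (h.congr_deriv ?_).deriv
  ring

theorem H₁_deriv_fst_snd :
    deriv (fun X => deriv (fun Y => H₁ M ν γ X Y) Y) X = -M * Real.sin X * Real.exp (-Y) := by
  simp only [H₁_deriv_snd]
  have h := ((((Real.hasDerivAt_cos X).const_mul M).mul_const (Real.exp (-Y))).sub_const
    (γ * Y)).sub_const ν
  rw [h.deriv]
  ring

theorem H₁_continuous_fst : Continuous fun X => H₁ M ν γ X Y := by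
  unfold H₁
  fun_prop

theorem H₁_continuous_snd : Continuous fun Y => H₁ M ν γ X Y := by
  unfold H₁
  fun_prop

variable {M ν γ X Y}

/-- At a critical point of `H₁`, second derivatives of opposite signs along the axes exclude a
local extremum. -/
theorem H₁_not_isLocalExtr (hsin : Real.sin X = 0)
    (hY : M * Real.cos X * Real.exp (-Y) - γ * Y - ν = 0)
    (h : 0 < M * Real.cos X * Real.exp (-Y) ∧ -M * Real.cos X * Real.exp (-Y) - γ < 0 ∨
      M * Real.cos X * Real.exp (-Y) < 0 ∧ 0 < -M * Real.cos X * Real.exp (-Y) - γ) :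
    ¬ IsLocalMax (fun p : ℝ × ℝ => H₁ M ν γ p.1 p.2) (X, Y) ∧
      ¬ IsLocalMin (fun p : ℝ × ℝ => H₁ M ν γ p.1 p.2) (X, Y) := by
  have c1 : ContinuousAt (fun x : ℝ => (x, Y)) X := by fun_prop
  have c2 : ContinuousAt (fun y : ℝ => (X, y)) Y := by fun_prop
  have d1 : deriv (fun X => H₁ M ν γ X Y) X = 0 := by simp [H₁_deriv_fst, hsin]
  have d2 : deriv (fun Y => H₁ M ν γ X Y) Y = 0 := by rw [H₁_deriv_snd]; exact hY
  have k1 := (H₁_continuous_fst M ν γ Y).continuousAt (x := X)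
  have k2 := (H₁_continuous_snd M ν γ X).continuousAt (x := Y)
  rw [← H₁_deriv_fst_fst M ν γ X Y, ← H₁_deriv_snd_snd M ν γ X Y] at h
  rcases h with ⟨h1, h2⟩ | ⟨h1, h2⟩
  · exact ⟨fun hm => not_isLocalMax_of_deriv_deriv_pos h1 d1 k1 (c1.tendsto.eventually hm),
      fun hm => not_isLocalMin_of_deriv_deriv_neg h2 d2 k2 (c2.tendsto.eventually hm)⟩
  · exact ⟨fun hm => not_isLocalMax_of_deriv_deriv_pos h2 d2 k2 (c2.tendsto.eventually hm),
      fun hm => not_isLocalMin_of_deriv_deriv_neg h1 d1 k1 (c1.tendsto.eventually hm)⟩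

theorem H₁_isLocalMax_zero (hM : M < 0) (hY : M * Real.exp (-Y) - ν - γ * Y = 0)
    (h : -M * Real.exp (-Y) - γ < 0) :
    IsLocalMax (fun p : ℝ × ℝ => H₁ M ν γ p.1 p.2) (0, Y) := by
  have hmax : IsLocalMax (fun y => H₁ M ν γ 0 y) Y := by
    refine isLocalMax_of_deriv_deriv_neg ?_ ?_ (H₁_continuous_snd M ν γ 0).continuousAt
    · rw [H₁_deriv_snd_snd]
      simpa using h
    · rw [H₁_deriv_snd]
      simp only [Real.cos_zero]
      linarith
  have hs : ContinuousAt (Prod.snd : ℝ × ℝ → ℝ) (0, Y) := by fun_prop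
  filter_upwards [hs.tendsto.eventually hmax] with p hp
  refine le_trans ?_ hp
  have h1 := mul_le_mul_of_nonneg_left (Real.cos_le_one p.1)
    (mul_pos (neg_pos.2 hM) (Real.exp_pos (-p.2))).le
  simp only [H₁, Real.cos_zero]
  linarith

end Hamiltonian

section Roots

variable {M ν γ : ℝ}

theorem existsUnique_trough_root (hγ : 0 < γ) (hM : M < 0) (hν : ν < 0) :
    ∃! Y : ℝ, -M * Real.exp (-Y) - ν - γ * Y = 0 := by
  have hanti : StrictAnti fun Y : ℝ => -M * Real.exp (-Y) - ν - γ * Y := by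
    intro a b hab
    have h1 := mul_lt_mul_of_pos_left (Real.exp_lt_exp.2 (neg_lt_neg hab)) (neg_pos.2 hM)
    have h2 := mul_lt_mul_of_pos_left hab hγ
    simp only
    linarith
  have hcont : Continuous fun Y : ℝ => -M * Real.exp (-Y) - ν - γ * Y := by fun_prop
  have ht : 0 ≤ (-M - ν) / γ := div_nonneg (by linarith) hγ.le
  have hmul : γ * ((-M - ν) / γ) = -M - ν := mul_div_cancel₀ _ hγ.ne'
  have hexp := mul_le_mul_of_nonneg_left (Real.exp_le_one_iff.2 (neg_nonpos.2 ht))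
    (neg_pos.2 hM).le
  obtain ⟨Y, -, hY⟩ := intermediate_value_Icc' ht hcont.continuousOn
    (show (0 : ℝ) ∈ Set.Icc _ _ from ⟨by linarith, by simp; linarith⟩)
  exact ⟨Y, hY, fun Z hZ => hanti.injective (hZ.trans hY.symm)⟩

theorem trough_root_pos (hγ : 0 < γ) (hM : M < 0) (hν : ν < 0) {Y : ℝ}
    (hY : -M * Real.exp (-Y) - ν - γ * Y = 0) : 0 < Y := by
  have h := mul_pos (neg_pos.2 hM) (Real.exp_pos (-Y))
  exact pos_of_mul_pos_right (a := γ) (by linarith) hγ.le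

/-- The function `Y ↦ M e^{-Y} - ν - γ Y` lies strictly below its tangent lines when `M < 0`. -/
theorem crest_lt_tangent (hM : M < 0) {Y Z : ℝ} (hne : Z ≠ Y) :
    M * Real.exp (-Z) - ν - γ * Z <
      M * Real.exp (-Y) - ν - γ * Y + (-M * Real.exp (-Y) - γ) * (Z - Y) := by
  have h1 : -(Z - Y) + 1 < Real.exp (-(Z - Y)) :=
    Real.add_one_lt_exp (neg_ne_zero.2 (sub_ne_zero.2 hne))
  have h2 : Real.exp (-Z) = Real.exp (-Y) * Real.exp (-(Z - Y)) := by
    rw [← Real.exp_add]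
    ring_nf
  have h3 := mul_lt_mul_of_pos_left h1 (mul_pos (neg_pos.2 hM) (Real.exp_pos (-Y)))
  rw [h2]
  linarith

theorem exists_crest_root_pos (hγ : 0 < γ) (hM : M < 0) (hν : ν < M) :
    ∃ Y : ℝ, 0 < Y ∧ M * Real.exp (-Y) - ν - γ * Y = 0 := by
  have hcont : Continuous fun Y : ℝ => M * Real.exp (-Y) - ν - γ * Y := by fun_prop
  have ht : 0 ≤ -ν / γ := div_nonneg (by linarith) hγ.le
  have hmul : γ * (-ν / γ) = -ν := mul_div_cancel₀ _ hγ.ne'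
  have hexp := mul_neg_of_neg_of_pos hM (Real.exp_pos (-(-ν / γ)))
  obtain ⟨Y, ⟨hY0, -⟩, hY⟩ := intermediate_value_Icc' ht hcont.continuousOn
    (show (0 : ℝ) ∈ Set.Icc _ _ from ⟨by linarith, by simp; linarith⟩)
  refine ⟨Y, lt_of_le_of_ne hY0 ?_, hY⟩
  rintro rfl
  simp at hY
  linarith

theorem exists_crest_root_neg (hγ : 0 < γ) (hM : M < 0) (hν : ν < M) :
    ∃ Y : ℝ, Y < 0 ∧ M * Real.exp (-Y) - ν - γ * Y = 0 := by
  have hcont : Continuous fun Y : ℝ => M * Real.exp (-Y) - ν - γ * Y := by fun_prop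
  obtain ⟨t, ht⟩ : ∃ t : ℝ, t = 2 * (-ν + γ - M) / -M := ⟨_, rfl⟩
  have hmul : -M * t = 2 * (-ν + γ - M) := by
    rw [ht]
    exact mul_div_cancel₀ _ (neg_pos.2 hM).ne'
  have ht1 : 1 ≤ t := by
    rw [ht, le_div_iff₀ (neg_pos.2 hM)]
    linarith
  have hexp := mul_le_mul_of_nonneg_left
    (Real.quadratic_le_exp_of_nonneg (zero_le_one.trans ht1)) (neg_pos.2 hM).le
  have hneg : M * Real.exp (- -t) - ν - γ * -t ≤ 0 := by
    rw [neg_neg]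
    have hsq : -M * t ^ 2 = 2 * (-ν + γ - M) * t := by rw [← hmul]; ring
    nlinarith
  obtain ⟨Y, ⟨-, hY0⟩, hY⟩ := intermediate_value_Icc (show -t ≤ 0 by linarith)
    hcont.continuousOn (show (0 : ℝ) ∈ Set.Icc _ _ from ⟨hneg, by simp; linarith⟩)
  refine ⟨Y, lt_of_le_of_ne hY0 ?_, hY⟩
  rintro rfl
  simp at hY
  linarith

theorem crest_slope_mul_neg (hM : M < 0) (hν : ν < M) {Y : ℝ} (hY0 : Y ≠ 0)
    (hY : M * Real.exp (-Y) - ν - γ * Y = 0) : (-M * Real.exp (-Y) - γ) * Y < 0 := by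
  have h := crest_lt_tangent (ν := ν) (γ := γ) hM hY0.symm
  rw [hY] at h
  simp at h
  linarith

/-- Two roots of `M e^{-Y} - ν - γ Y` on the same side of the origin coincide. -/
theorem crest_root_unique (hM : M < 0) (hν : ν < M) {Y Z : ℝ} (hYZ : 0 < Y * Z)
    (hY : M * Real.exp (-Y) - ν - γ * Y = 0) (hZ : M * Real.exp (-Z) - ν - γ * Z = 0) :
    Y = Z := by
  by_contra hne
  have sY := crest_slope_mul_neg hM hν (left_ne_zero_of_mul hYZ.ne') hY
  have sZ := crest_slope_mul_neg hM hν (right_ne_zero_of_mul hYZ.ne') hZ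
  have tY := crest_lt_tangent (ν := ν) (γ := γ) hM (Ne.symm hne)
  have tZ := crest_lt_tangent (ν := ν) (γ := γ) hM hne
  rw [hY, hZ] at tY tZ
  rcases lt_or_gt_of_ne (left_ne_zero_of_mul hYZ.ne') with h | h
  · have hZ0 := neg_of_mul_pos_right hYZ h.le
    have pY := pos_of_mul_neg_left sY h.le
    have pZ := pos_of_mul_neg_left sZ hZ0.le
    nlinarith
  · have hZ0 := pos_of_mul_pos_right hYZ h.le
    have pY := neg_of_mul_neg_left sY h.le
    have pZ := neg_of_mul_neg_left sZ hZ0.le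
    nlinarith

end Roots

/-- the critical-layer regime `A = 1`, `γ₁ > 0`, `𝔠 < 0`, with
`ε₁ ∈ (0,1)`, `ε₁e^{ε₁} < 1` and `M₁ = ε₁k𝔠 < 0`.
(a) there is exactly one `Ȳ` with `−M₁e^{−Ȳ} − k𝔠 − γ₁Ȳ = 0`; it is positive
and `(π,Ȳ)` is a nondegenerate saddle of `H₁` with diagonal Hessian entries
`−M₁e^{−Ȳ} > 0` and `M₁e^{−Ȳ} − γ₁ < 0`.
(b) `M₁e^{−Y} − k𝔠 − γ₁Y = 0` has exactly two real solutions `Y⁻ < 0 < Y⁺`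
with `−M₁e^{−Y⁺} < γ₁ < −M₁e^{−Y⁻}`; `(0,Y⁺)` is a nondegenerate local
maximum of `H₁` (the cat's-eye vortex centre) and `(0,Y⁻)` a nondegenerate
saddle. -/
theorem stmt9 (γ₁ k 𝔠 ε₁ M₁ : ℝ) (hγ : 0 < γ₁) (hk : 0 < k) (h𝔠 : 𝔠 < 0)
    (hε : 0 < ε₁) (hε1 : ε₁ < 1) (hcond : ε₁ * Real.exp ε₁ < 1)
    (hM : M₁ = ε₁ * (k * 𝔠)) :
    ((∃! Yb : ℝ, -M₁ * Real.exp (-Yb) - k * 𝔠 - γ₁ * Yb = 0) ∧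
      ∀ Yb : ℝ, -M₁ * Real.exp (-Yb) - k * 𝔠 - γ₁ * Yb = 0 →
        0 < Yb ∧
        deriv (deriv (fun X => H₁ M₁ (k * 𝔠) γ₁ X Yb)) Real.pi
          = -M₁ * Real.exp (-Yb) ∧
        deriv (deriv (fun Y => H₁ M₁ (k * 𝔠) γ₁ Real.pi Y)) Yb
          = M₁ * Real.exp (-Yb) - γ₁ ∧
        deriv (fun X => deriv (fun Y => H₁ M₁ (k * 𝔠) γ₁ X Y) Yb) Real.pi = 0 ∧
        0 < -M₁ * Real.exp (-Yb) ∧ M₁ * Real.exp (-Yb) - γ₁ < 0 ∧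
        ¬ IsLocalMax (fun p : ℝ × ℝ => H₁ M₁ (k * 𝔠) γ₁ p.1 p.2)
          (Real.pi, Yb) ∧
        ¬ IsLocalMin (fun p : ℝ × ℝ => H₁ M₁ (k * 𝔠) γ₁ p.1 p.2)
          (Real.pi, Yb)) ∧
    ∃ Ym Yp : ℝ, Ym < 0 ∧ 0 < Yp ∧
      M₁ * Real.exp (-Ym) - k * 𝔠 - γ₁ * Ym = 0 ∧
      M₁ * Real.exp (-Yp) - k * 𝔠 - γ₁ * Yp = 0 ∧
      (∀ Y : ℝ, M₁ * Real.exp (-Y) - k * 𝔠 - γ₁ * Y = 0 → Y = Ym ∨ Y = Yp) ∧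
      -M₁ * Real.exp (-Yp) < γ₁ ∧ γ₁ < -M₁ * Real.exp (-Ym) ∧
      deriv (deriv (fun X => H₁ M₁ (k * 𝔠) γ₁ X Yp)) 0 = M₁ * Real.exp (-Yp) ∧
      deriv (deriv (fun Y => H₁ M₁ (k * 𝔠) γ₁ 0 Y)) Yp
        = -M₁ * Real.exp (-Yp) - γ₁ ∧
      deriv (fun X => deriv (fun Y => H₁ M₁ (k * 𝔠) γ₁ X Y) Yp) 0 = 0 ∧
      M₁ * Real.exp (-Yp) < 0 ∧ -M₁ * Real.exp (-Yp) - γ₁ < 0 ∧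
      IsLocalMax (fun p : ℝ × ℝ => H₁ M₁ (k * 𝔠) γ₁ p.1 p.2) (0, Yp) ∧
      deriv (deriv (fun X => H₁ M₁ (k * 𝔠) γ₁ X Ym)) 0 = M₁ * Real.exp (-Ym) ∧
      deriv (deriv (fun Y => H₁ M₁ (k * 𝔠) γ₁ 0 Y)) Ym
        = -M₁ * Real.exp (-Ym) - γ₁ ∧
      deriv (fun X => deriv (fun Y => H₁ M₁ (k * 𝔠) γ₁ X Y) Ym) 0 = 0 ∧
      M₁ * Real.exp (-Ym) < 0 ∧ 0 < -M₁ * Real.exp (-Ym) - γ₁ ∧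
      ¬ IsLocalMax (fun p : ℝ × ℝ => H₁ M₁ (k * 𝔠) γ₁ p.1 p.2) (0, Ym) ∧
      ¬ IsLocalMin (fun p : ℝ × ℝ => H₁ M₁ (k * 𝔠) γ₁ p.1 p.2) (0, Ym) := by
  have hν : k * 𝔠 < 0 := mul_neg_of_pos_of_neg hk h𝔠
  have hM0 : M₁ < 0 := hM ▸ mul_neg_of_pos_of_neg hε hν
  have hνM : k * 𝔠 < M₁ := by rw [hM]; nlinarith
  have hexp (Y : ℝ) : M₁ * Real.exp (-Y) < 0 := mul_neg_of_neg_of_pos hM0 (Real.exp_pos _)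
  refine ⟨⟨existsUnique_trough_root hγ hM0 hν, fun Yb hYb => ?_⟩, ?_⟩
  · have hE := hexp Yb
    obtain ⟨hmax, hmin⟩ := H₁_not_isLocalExtr (M := M₁) (ν := k * 𝔠) (γ := γ₁) (Y := Yb)
      Real.sin_pi (by rw [Real.cos_pi]; linarith)
      (Or.inl ⟨by rw [Real.cos_pi]; linarith, by rw [Real.cos_pi]; linarith⟩)
    refine ⟨trough_root_pos hγ hM0 hν hYb, ?_, ?_, ?_, by linarith, by linarith, hmax, hmin⟩
    · rw [H₁_deriv_fst_fst, Real.cos_pi]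
      ring
    · rw [H₁_deriv_snd_snd, Real.cos_pi]
      ring
    · simp [H₁_deriv_fst_snd]
  · obtain ⟨Ym, hm0, hm⟩ := exists_crest_root_neg hγ hM0 hνM
    obtain ⟨Yp, hp0, hp⟩ := exists_crest_root_pos hγ hM0 hνM
    have sm : 0 < -M₁ * Real.exp (-Ym) - γ₁ :=
      pos_of_mul_neg_left (crest_slope_mul_neg hM0 hνM hm0.ne hm) hm0.le
    have sp : -M₁ * Real.exp (-Yp) - γ₁ < 0 :=
      neg_of_mul_neg_left (crest_slope_mul_neg hM0 hνM hp0.ne' hp) hp0.le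
    obtain ⟨hmax, hmin⟩ := H₁_not_isLocalExtr (M := M₁) (ν := k * 𝔠) (γ := γ₁) (Y := Ym)
      Real.sin_zero (by rw [Real.cos_zero]; linarith)
      (Or.inr ⟨by simpa using hexp Ym, by simpa using sm⟩)
    refine ⟨Ym, Yp, hm0, hp0, hm, hp, fun Y hY => ?_, by linarith, by linarith,
      by simp [H₁_deriv_fst_fst], by simp [H₁_deriv_snd_snd], by simp [H₁_deriv_fst_snd],
      hexp Yp, sp, H₁_isLocalMax_zero hM0 hp sp,
      by simp [H₁_deriv_fst_fst], by simp [H₁_deriv_snd_snd], by simp [H₁_deriv_fst_snd],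
      hexp Ym, sm, hmax, hmin⟩
    rcases lt_trichotomy Y 0 with h | rfl | h
    · exact Or.inl (crest_root_unique hM0 hνM (mul_pos_of_neg_of_neg h hm0) hY hm)
    · simp at hY
      linarith
    · exact Or.inr (crest_root_unique hM0 hνM (mul_pos h hp0) hY hp)
end

section
/- Let A ∈ (−1,1), k > 0, 𝔠 < 0, γ₁ > 0 (the critical-layer regime), ε₁ ∈ (0,1), set M₁ := ε₁·k𝔠 < 0 and ℜ := √(1−A²)·M₁/γ₁, and assume |ℜ| < 1, arcosh(1/|ℜ|) − tanh(arcosh(1/|ℜ|)) > |k𝔠/γ₁ + (1/2)·log((1+A)/(1−A))|, and k𝔠 ≠ −(γ₁/2)·log((1+A)/(1−A)). Then the set of singular points {(X,Y) ∈ [−π,π]×ℝ : F(X,Y) = 0 and G(X,Y) = 0} has exactly 5 elements; more precisely, all singular points satisfy X ∈ {−π, 0, π}, the function Y ↦ F(0,Y) has exactly three real zeros, and the function Y ↦ F(π,Y) = F(−π,Y) has exactly one real zero. -/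
/-- The inverse hyperbolic cosine (principal branch), for `x ≥ 1`. -/
noncomputable def arcosh (x : ℝ) : ℝ :=
  Real.log (x + Real.sqrt (x ^ 2 - 1))

/-- Horizontal velocity `F(X,Y) = M₁ cos X (A cosh Y − sinh Y) − ν − γ₁Y`
of the upper-layer travelling-wave system, with `ν = k𝔠`. -/
noncomputable def Fup (M₁ ν γ₁ A X Y : ℝ) : ℝ :=
  M₁ * Real.cos X * (A * Real.cosh Y - Real.sinh Y) - ν - γ₁ * Y

/-- Vertical velocity `G(X,Y) = M₁ sin X (A sinh Y − cosh Y)`. -/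
noncomputable def Gup (M₁ A X Y : ℝ) : ℝ :=
  M₁ * Real.sin X * (A * Real.sinh Y - Real.cosh Y)

theorem hasDerivAt_mul_sinh_sub (r u : ℝ) :
    HasDerivAt (fun u => r * Real.sinh u - u) (r * Real.cosh u - 1) u :=
  ((Real.hasDerivAt_sinh u).const_mul r).sub (hasDerivAt_id u)

theorem continuous_mul_sinh_sub (r : ℝ) : Continuous fun u => r * Real.sinh u - u := by
  fun_prop

theorem strictMonoOn_mul_sinh_sub {r a : ℝ} (hr : 0 < r) (ha : 0 ≤ a)
    (hra : r * Real.cosh a = 1) :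
    StrictMonoOn (fun u => r * Real.sinh u - u) (Set.Ici a) := by
  refine strictMonoOn_of_deriv_pos (convex_Ici a) (continuous_mul_sinh_sub r).continuousOn ?_
  intro u hu
  rw [interior_Ici, Set.mem_Ioi] at hu
  rw [(hasDerivAt_mul_sinh_sub r u).deriv]
  have h : Real.cosh a < Real.cosh u := by
    rw [Real.cosh_lt_cosh, abs_of_nonneg ha, abs_of_pos (ha.trans_lt hu)]
    exact hu
  nlinarith

theorem strictAntiOn_mul_sinh_sub {r a : ℝ} (hr : 0 < r) (ha : 0 ≤ a)
    (hra : r * Real.cosh a = 1) :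
    StrictAntiOn (fun u => r * Real.sinh u - u) (Set.Icc (-a) a) := by
  refine strictAntiOn_of_deriv_neg (convex_Icc (-a) a)
    (continuous_mul_sinh_sub r).continuousOn ?_
  intro u hu
  rw [interior_Icc, Set.mem_Ioo] at hu
  rw [(hasDerivAt_mul_sinh_sub r u).deriv]
  have h : Real.cosh u < Real.cosh a := by
    rw [Real.cosh_lt_cosh, abs_of_nonneg ha, abs_lt]
    exact hu
  nlinarith

theorem exists_le_mul_sinh_sub {r : ℝ} (hr : 0 < r) (a d : ℝ) :
    ∃ u, a ≤ u ∧ d ≤ r * Real.sinh u - u := by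
  set u := max a (max 1 (4 * (1 + |d|) / r)) with hu
  have h1 : 1 ≤ u := (le_max_left _ _).trans (le_max_right _ _)
  have h2 : 4 * (1 + |d|) / r ≤ u := (le_max_right _ _).trans (le_max_right _ _)
  refine ⟨u, le_max_left _ _, ?_⟩
  rw [div_le_iff₀ hr] at h2
  have h3 : u ^ 2 / 4 ≤ Real.sinh u := by
    rw [Real.sinh_eq]
    have := Real.quadratic_le_exp_of_nonneg (x := u) (by linarith)
    have := Real.exp_le_one_iff.2 (show -u ≤ 0 by linarith)
    nlinarith
  have h4 : r * (u ^ 2 / 4) ≤ r * Real.sinh u := mul_le_mul_of_nonneg_left h3 hr.le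
  have h5 : u * (4 * (1 + |d|)) ≤ u * (u * r) :=
    mul_le_mul_of_nonneg_left h2 (by linarith)
  nlinarith [abs_nonneg d, le_abs_self d]

theorem exists_unique_ge_mul_sinh_sub_eq {r a d : ℝ} (hr : 0 < r) (ha : 0 ≤ a)
    (hra : r * Real.cosh a = 1) (hd : r * Real.sinh a - a < d) :
    ∃ z, a < z ∧ ∀ u, a ≤ u → (r * Real.sinh u - u = d ↔ u = z) := by
  obtain ⟨b, hab, hb⟩ := exists_le_mul_sinh_sub hr a d
  obtain ⟨z, hz, hzd⟩ := intermediate_value_Icc hab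
    (continuous_mul_sinh_sub r).continuousOn ⟨hd.le, hb⟩
  dsimp only at hzd
  refine ⟨z, lt_of_le_of_ne hz.1 ?_, fun u hu => ⟨fun h => ?_, fun h => h ▸ hzd⟩⟩
  · rintro rfl
    exact hd.ne hzd
  · exact (strictMonoOn_mul_sinh_sub hr ha hra).injOn hu hz.1 (h.trans hzd.symm)

theorem exists_three_mul_sinh_sub_eq {r a d : ℝ} (hr : 0 < r) (ha : 0 ≤ a)
    (hra : r * Real.cosh a = 1) (hd : |d| < a - r * Real.sinh a) :
    ∃ x y z, x < y ∧ y < z ∧ ∀ u, r * Real.sinh u - u = d ↔ u = x ∨ u = y ∨ u = z := by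
  obtain ⟨hd1, hd2⟩ := abs_lt.1 hd
  obtain ⟨z, hz, hzd⟩ := exists_unique_ge_mul_sinh_sub_eq (d := d) hr ha hra (by linarith)
  obtain ⟨x, hx, hxd⟩ := exists_unique_ge_mul_sinh_sub_eq (d := -d) hr ha hra (by linarith)
  obtain ⟨y, hy, hyd⟩ := intermediate_value_Icc' (show -a ≤ a by linarith)
    (continuous_mul_sinh_sub r).continuousOn
    (show d ∈ Set.Icc (r * Real.sinh a - a) (r * Real.sinh (-a) - -a) by
      rw [Real.sinh_neg]
      constructor <;> linarith)
  dsimp only at hyd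
  refine ⟨-x, y, z, by linarith [hy.1], by linarith [hy.2], fun u => ⟨fun h => ?_, ?_⟩⟩
  · rcases le_total a u with hu | hu
    · exact Or.inr (Or.inr ((hzd u hu).1 h))
    rcases le_total u (-a) with hu' | hu'
    · left
      rw [← (hxd (-u) (by linarith)).1 (by rw [Real.sinh_neg]; linarith), neg_neg]
    · exact Or.inr (Or.inl ((strictAntiOn_mul_sinh_sub hr ha hra).injOn ⟨hu', hu⟩ hy
        (h.trans hyd.symm)))
  · rintro (rfl | rfl | rfl)
    · have := (hxd x hx.le).2 rfl
      rw [Real.sinh_neg]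
      linarith
    · exact hyd
    · exact (hzd _ hz.le).2 rfl

theorem existsUnique_neg_mul_sinh_sub_eq {r : ℝ} (hr : 0 < r) (d : ℝ) :
    ∃ z, ∀ u, -(r * Real.sinh u) - u = d ↔ u = z := by
  have hanti : StrictAnti fun u => -(r * Real.sinh u) - u := by
    intro u v huv
    have := mul_lt_mul_of_pos_left (Real.sinh_lt_sinh.2 huv) hr
    dsimp only
    linarith
  have hcont : Continuous fun u => -(r * Real.sinh u) - u := by fun_prop
  obtain ⟨b, hb0, hb⟩ := exists_le_mul_sinh_sub hr 0 |d|
  obtain ⟨z, -, hz⟩ := intermediate_value_Icc' (show -b ≤ b by linarith) hcont.continuousOn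
    (show d ∈ Set.Icc (-(r * Real.sinh b) - b) (-(r * Real.sinh (-b)) - -b) by
      rw [Real.sinh_neg]
      constructor <;> linarith [neg_abs_le d, le_abs_self d])
  exact ⟨z, fun u => ⟨fun h => hanti.injective (h.trans hz.symm), fun h => h ▸ hz⟩⟩

theorem mul_cosh_sub_sinh_eq {A : ℝ} (hA : -1 < A) (hA' : A < 1) (Y : ℝ) :
    A * Real.cosh Y - Real.sinh Y =
      -(Real.sqrt (1 - A ^ 2) * Real.sinh (Y - (1 / 2) * Real.log ((1 + A) / (1 - A)))) := by
  rw [← Real.artanh_eq_half_log (Set.mem_Icc.2 ⟨hA.le, hA'.le⟩), Real.sinh_sub,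
    Real.sinh_artanh ⟨hA, hA'⟩, Real.cosh_artanh ⟨hA, hA'⟩]
  have : 0 < Real.sqrt (1 - A ^ 2) := Real.sqrt_pos.2 (by nlinarith)
  field_simp
  ring

theorem mul_sinh_sub_cosh_neg {A : ℝ} (hA : -1 < A) (hA' : A < 1) (Y : ℝ) :
    A * Real.sinh Y - Real.cosh Y < 0 := by
  rw [Real.sinh_eq, Real.cosh_eq]
  nlinarith [mul_pos (sub_pos.2 hA') (Real.exp_pos Y),
    mul_pos (neg_lt_iff_pos_add'.1 hA) (Real.exp_pos (-Y))]

theorem Real.sin_eq_zero_of_mem_Icc {X : ℝ} (hX : X ∈ Set.Icc (-Real.pi) Real.pi)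
    (h : Real.sin X = 0) : X = -Real.pi ∨ X = 0 ∨ X = Real.pi := by
  rcases hX.1.eq_or_lt with h1 | h1
  · exact Or.inl h1.symm
  rcases hX.2.eq_or_lt with h2 | h2
  · exact Or.inr (Or.inr h2)
  · exact Or.inr (Or.inl ((Real.sin_eq_zero_iff_of_lt_of_lt h1 h2).1 h))

/-- the critical-layer regime `|A| < 1`, `γ₁ > 0`, `𝔠 < 0`,
`|ℜ| < 1` under the stated conditions: the system has exactly `5` singular
points in `[−π,π] × ℝ`, all on `X ∈ {−π,0,π}`, with `F(0,·)` having three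
zeros and `F(±π,·)` one. -/
theorem stmt15 (A k 𝔠 γ₁ ε₁ M₁ R : ℝ) (hA : -1 < A) (hA' : A < 1)
    (hk : 0 < k) (h𝔠 : 𝔠 < 0) (hγ : 0 < γ₁) (hε : 0 < ε₁) (hε1 : ε₁ < 1)
    (hM : M₁ = ε₁ * (k * 𝔠)) (hR : R = Real.sqrt (1 - A ^ 2) * M₁ / γ₁)
    (hR1 : |R| < 1)
    (hcond : arcosh (1 / |R|) - Real.tanh (arcosh (1 / |R|)) >
      |k * 𝔠 / γ₁ + (1 / 2) * Real.log ((1 + A) / (1 - A))|)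
    (hne : k * 𝔠 ≠ -(γ₁ / 2) * Real.log ((1 + A) / (1 - A))) :
    {p : ℝ × ℝ | p.1 ∈ Set.Icc (-Real.pi) Real.pi ∧
        Fup M₁ (k * 𝔠) γ₁ A p.1 p.2 = 0 ∧ Gup M₁ A p.1 p.2 = 0}.ncard = 5 ∧
    (∀ p : ℝ × ℝ, p.1 ∈ Set.Icc (-Real.pi) Real.pi →
        Fup M₁ (k * 𝔠) γ₁ A p.1 p.2 = 0 → Gup M₁ A p.1 p.2 = 0 →
        p.1 = -Real.pi ∨ p.1 = 0 ∨ p.1 = Real.pi) ∧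
    {Y : ℝ | Fup M₁ (k * 𝔠) γ₁ A 0 Y = 0}.ncard = 3 ∧
    (∀ Y : ℝ, Fup M₁ (k * 𝔠) γ₁ A Real.pi Y
        = Fup M₁ (k * 𝔠) γ₁ A (-Real.pi) Y) ∧
    {Y : ℝ | Fup M₁ (k * 𝔠) γ₁ A Real.pi Y = 0}.ncard = 1 := by
  have hM0 : M₁ < 0 := hM ▸ mul_neg_of_pos_of_neg hε (mul_neg_of_pos_of_neg hk h𝔠)
  have hs : 0 < Real.sqrt (1 - A ^ 2) := Real.sqrt_pos.2 (by nlinarith)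
  have hR0 : R < 0 := hR ▸ div_neg_of_neg_of_pos (mul_neg_of_pos_of_neg hs hM0) hγ
  rw [abs_of_neg hR0] at hR1 hcond
  have hRγ : γ₁ * -R = -(Real.sqrt (1 - A ^ 2) * M₁) := by
    rw [hR]
    field_simp
  set r := -R with hr
  have hr0 : 0 < r := by linarith
  have hr1 : 1 ≤ 1 / r := (one_le_div hr0).2 hR1.le
  set L := (1 / 2) * Real.log ((1 + A) / (1 - A)) with hL
  set d := k * 𝔠 / γ₁ + L with hd
  have hdγ : γ₁ * d = k * 𝔠 + γ₁ * L := by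
    rw [hd]
    field_simp
  have ha : 0 ≤ arcosh (1 / r) := Real.arcosh_nonneg hr1
  have hra : r * Real.cosh (arcosh (1 / r)) = 1 := by
    have : Real.cosh (arcosh (1 / r)) = 1 / r := Real.cosh_arcosh hr1
    rw [this, mul_one_div_cancel hr0.ne']
  have htanh : Real.tanh (arcosh (1 / r)) = r * Real.sinh (arcosh (1 / r)) := by
    rw [Real.tanh_eq_sinh_div_cosh, div_eq_iff (Real.cosh_pos _).ne']
    linear_combination -Real.sinh (arcosh (1 / r)) * hra
  rw [htanh] at hcond
  have hF (X Y : ℝ) : Fup M₁ (k * 𝔠) γ₁ A X Y =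
      γ₁ * (Real.cos X * (r * Real.sinh (Y - L)) - (Y - L) - d) := by
    rw [Fup, mul_cosh_sub_sinh_eq hA hA', ← hL]
    linear_combination -Real.cos X * Real.sinh (Y - L) * hRγ + hdγ
  obtain ⟨x, y, z, hxy, hyz, h3⟩ := exists_three_mul_sinh_sub_eq hr0 ha hra hcond
  obtain ⟨w, h1⟩ := existsUnique_neg_mul_sinh_sub_eq hr0 d
  have hF0 (Y : ℝ) : Fup M₁ (k * 𝔠) γ₁ A 0 Y = 0 ↔ Y = x + L ∨ Y = y + L ∨ Y = z + L := by
    rw [hF, mul_eq_zero_iff_left hγ.ne', Real.cos_zero, one_mul, sub_eq_zero, h3]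
    simp only [sub_eq_iff_eq_add]
  have hFπ (Y : ℝ) : Fup M₁ (k * 𝔠) γ₁ A Real.pi Y = 0 ↔ Y = w + L := by
    rw [hF, mul_eq_zero_iff_left hγ.ne', Real.cos_pi, neg_one_mul, sub_eq_zero, h1,
      sub_eq_iff_eq_add]
  have hFneg (Y : ℝ) : Fup M₁ (k * 𝔠) γ₁ A Real.pi Y = Fup M₁ (k * 𝔠) γ₁ A (-Real.pi) Y := by
    simp only [Fup, Real.cos_neg]
  have hX (p : ℝ × ℝ) (hp : p.1 ∈ Set.Icc (-Real.pi) Real.pi) (hG : Gup M₁ A p.1 p.2 = 0) :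
      p.1 = -Real.pi ∨ p.1 = 0 ∨ p.1 = Real.pi := by
    rw [Gup, mul_eq_zero_iff_right (mul_sinh_sub_cosh_neg hA hA' p.2).ne,
      mul_eq_zero_iff_left hM0.ne] at hG
    exact Real.sin_eq_zero_of_mem_Icc hp hG
  have hπ := Real.pi_pos
  refine ⟨?_, fun p hp _ hG => hX p hp hG, ?_, hFneg, ?_⟩
  · have hset : {p : ℝ × ℝ | p.1 ∈ Set.Icc (-Real.pi) Real.pi ∧
        Fup M₁ (k * 𝔠) γ₁ A p.1 p.2 = 0 ∧ Gup M₁ A p.1 p.2 = 0} =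
        (({(0, x + L), (0, y + L), (0, z + L), (Real.pi, w + L), (-Real.pi, w + L)} :
          Finset (ℝ × ℝ)) : Set (ℝ × ℝ)) := by
      ext ⟨X, Y⟩
      simp only [Set.mem_ofPred_eq, Finset.coe_insert, Finset.coe_singleton, Set.mem_insert_iff,
        Set.mem_singleton_iff, Prod.mk.injEq]
      constructor
      · rintro ⟨hXI, hFX, hG⟩
        rcases hX (X, Y) hXI hG with h | h | h <;> dsimp only at h <;> subst h
        · rw [← hFneg, hFπ] at hFX
          tauto
        · rw [hF0] at hFX
          tauto
        · rw [hFπ] at hFX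
          tauto
      · have h0 : (0 : ℝ) ∈ Set.Icc (-Real.pi) Real.pi := ⟨by linarith, hπ.le⟩
        rintro (⟨rfl, h⟩ | ⟨rfl, h⟩ | ⟨rfl, h⟩ | ⟨rfl, h⟩ | ⟨rfl, h⟩)
        · exact ⟨h0, (hF0 Y).2 (by tauto), by simp [Gup]⟩
        · exact ⟨h0, (hF0 Y).2 (by tauto), by simp [Gup]⟩
        · exact ⟨h0, (hF0 Y).2 (by tauto), by simp [Gup]⟩
        · exact ⟨⟨by linarith, le_rfl⟩, (hFπ Y).2 h, by simp [Gup]⟩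
        · exact ⟨⟨le_rfl, by linarith⟩, (hFneg Y) ▸ (hFπ Y).2 h, by simp [Gup]⟩
    have hππ : Real.pi ≠ -Real.pi := by linarith
    rw [hset, Set.ncard_coe_finset]
    simp [Finset.card_insert_of_notMem, hxy.ne, hyz.ne, (hxy.trans hyz).ne, hπ.ne, hπ.ne', hππ]
  · have hset : {Y : ℝ | Fup M₁ (k * 𝔠) γ₁ A 0 Y = 0} =
        (({x + L, y + L, z + L} : Finset ℝ) : Set ℝ) := by
      ext Y
      simp [hF0]
    rw [hset, Set.ncard_coe_finset]
    simp [Finset.card_insert_of_notMem, hxy.ne, hyz.ne, (hxy.trans hyz).ne]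
  · simp only [hFπ, Set.ofPred_eq_eq_singleton, Set.ncard_singleton]
end
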